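/- For all integers n ≥ 2 and r ≥ 1, define A_{n,r} : ℍ → ℂ by A_{n,r}(τ) = ∫₀¹ ((2πi·t)^{r−1}/(r−1)!) · f_n(t,τ) dt. Then the ℂ-vector subspace of the space of functions ℍ → ℂ spanned by the weight-(1−r) slash translates τ ↦ (cτ+d)^{r−1} · A_{n,r}((aτ+b)/(cτ+d)), taken over all matrices (a b; c d) ∈ SL₂(ℤ), is finite dimensional. -/

import Mathlib

open scoped Real Nat
open Finset MeasureTheory

/-- The coefficients `f_n(ξ,τ)` of the expansion of the Kronecker function:
`f₀ = 2πi`, `f₁(ξ,τ) = π cot(πξ) − 2πi Σ_{m,p≥1}(e^{2πimξ} − e^{−2πimξ}) q^{mp}` and, for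
`n ≥ 2`, `f_n(ξ,τ) = (2πi/(n−1)!)(Bₙ/n − Σ_{m,p≥1}(e^{2πimξ} + (−1)ⁿ e^{−2πimξ}) p^{n−1} q^{mp})`
(Bernoulli numbers with `B₁ = −1/2`). -/
noncomputable def fKr : ℕ → ℂ → ℂ → ℂ
  | 0, _, _ => 2 * ↑π * Complex.I
  | 1, ξ, τ =>
      ↑π * Complex.cot (↑π * ξ) -
        2 * ↑π * Complex.I *
          ∑' mp : ℕ × ℕ,
            (Complex.exp (2 * ↑π * Complex.I * ((mp.1 : ℂ) + 1) * ξ) -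
                Complex.exp (-(2 * ↑π * Complex.I * ((mp.1 : ℂ) + 1) * ξ))) *
              Complex.exp (2 * ↑π * Complex.I * τ) ^ ((mp.1 + 1) * (mp.2 + 1))
  | (n + 2), ξ, τ =>
      (2 * ↑π * Complex.I / ((n + 1)! : ℂ)) *
        ((bernoulli (n + 2) : ℂ) / ((n : ℂ) + 2) -
          ∑' mp : ℕ × ℕ,
            (Complex.exp (2 * ↑π * Complex.I * ((mp.1 : ℂ) + 1) * ξ) +
                (-1 : ℂ) ^ (n + 2) *
                  Complex.exp (-(2 * ↑π * Complex.I * ((mp.1 : ℂ) + 1) * ξ))) *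
              ((mp.2 : ℂ) + 1) ^ (n + 1) *
              Complex.exp (2 * ↑π * Complex.I * τ) ^ ((mp.1 + 1) * (mp.2 + 1)))

/-- `ω_n(ξ,τ) = Σ_{k=0}^{n} ((Im ξ/Im τ)^k / k!) · f_{n−k}(ξ,τ)`. -/
noncomputable def omKr (n : ℕ) (ξ τ : ℂ) : ℂ :=
  ∑ k ∈ Finset.range (n + 1),
    (((ξ.im / τ.im) ^ k / (k ! : ℝ) : ℝ) : ℂ) * fKr (n - k) ξ τ

/-- The open simplex `{1 > t₁ > ⋯ > t_r > 0}` in `(Fin r → ℝ)`. -/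
def openSimplex (r : ℕ) : Set (Fin r → ℝ) :=
  {t | (∀ i, 0 < t i ∧ t i < 1) ∧ ∀ i j : Fin r, i < j → t j < t i}

/-- The A-elliptic multiple zeta value
`A(n₁,…,n_r;τ) = ∫_{1>t₁>⋯>t_r>0} f_{n₁}(t₁,τ)⋯f_{n_r}(t_r,τ) dt`. -/
noncomputable def Aell {r : ℕ} (n : Fin r → ℕ) (τ : ℂ) : ℂ :=
  ∫ t in openSimplex r, ∏ i, fKr (n i) ((t i : ℝ) : ℂ) τ

/-- The B-elliptic multiple zeta value
`B(n₁,…,n_r;τ) = τ^{n₁+⋯+n_r} ∫_{1>t₁>⋯>t_r>0} ω_{n₁}(τt₁,τ)⋯ω_{n_r}(τt_r,τ) dt`. -/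
noncomputable def Bell {r : ℕ} (n : Fin r → ℕ) (τ : ℂ) : ℂ :=
  τ ^ (∑ i, n i) * ∫ t in openSimplex r, ∏ i, omKr (n i) (τ * ((t i : ℝ) : ℂ)) τ

/-- The depth-one A-elliptic multiple zeta value
`A_{n,r}(τ) = ∫₀¹ ((2πit)^{r−1}/(r−1)!) f_n(t,τ) dt` (i.e. `A(n,0,…,0;τ)` with `r−1` zeros). -/
noncomputable def AellDepthOne (n r : ℕ) (τ : ℂ) : ℂ :=
  ∫ t in Set.Ioo (0 : ℝ) 1,
    ((2 * ↑π * Complex.I * ((t : ℝ) : ℂ)) ^ (r - 1) / ((r - 1)! : ℂ)) *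
      fKr n ((t : ℝ) : ℂ) τ

open Polynomial in
/-- Functions whose derivative on the upper half-plane is `P · h` for some polynomial `P` of
degree less than `a`. -/
def polyPrimitive (h : ℂ → ℂ) (a : ℕ) : Submodule ℂ (ℂ → ℂ) where
  carrier := {J | ∃ P ∈ degreeLT ℂ a, ∀ z : ℂ, 0 < z.im → HasDerivAt J (P.eval z * h z) z}
  zero_mem' := ⟨0, zero_mem _, fun z _ => by simp⟩
  add_mem' := by
    rintro J K ⟨P, hP, hJ⟩ ⟨Q, hQ, hK⟩
    refine ⟨P + Q, add_mem hP hQ, fun z hz => ?_⟩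
    simpa [add_mul] using (hJ z hz).add (hK z hz)
  smul_mem' := by
    rintro c J ⟨P, hP, hJ⟩
    refine ⟨c • P, Submodule.smul_mem _ c hP, fun z hz => ?_⟩
    simpa [mul_assoc] using (hJ z hz).const_smul c

lemma const_mem_polyPrimitive (h : ℂ → ℂ) (a : ℕ) (c : ℂ) :
    (fun _ => c) ∈ polyPrimitive h a :=
  ⟨0, zero_mem _, fun z _ => by simp [hasDerivAt_const]⟩

lemma polyPrimitive_mono (h : ℂ → ℂ) {a b : ℕ} (hab : a ≤ b) :
    polyPrimitive h a ≤ polyPrimitive h b := by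
  rintro J ⟨P, hP, hJ⟩
  exact ⟨P, Polynomial.degreeLT_mono hab hP, hJ⟩

/-- The span of the functions `z ↦ z ^ b * J z` with `J ∈ polyPrimitive h a` and `a + b = s`. -/
def iteratedPrimitive (h : ℂ → ℂ) (s : ℕ) : Submodule ℂ (ℂ → ℂ) :=
  Submodule.span ℂ {f | ∃ a b : ℕ, a + b = s ∧ ∃ J ∈ polyPrimitive h a, f = fun z => z ^ b * J z}

lemma const_mem_iteratedPrimitive (h : ℂ → ℂ) (s : ℕ) (c : ℂ) :
    (fun _ => c) ∈ iteratedPrimitive h s :=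
  Submodule.subset_span ⟨s, 0, by simp, _, const_mem_polyPrimitive h s c, by simp⟩

lemma exists_primitive_mem_iteratedPrimitive {h : ℂ → ℂ}
    (hprim : ∀ P : Polynomial ℂ, ∃ K : ℂ → ℂ, ∀ z : ℂ, 0 < z.im →
      HasDerivAt K (P.eval z * h z) z)
    {s : ℕ} {f : ℂ → ℂ} (hf : f ∈ iteratedPrimitive h s) :
    ∃ F ∈ iteratedPrimitive h (s + 1), ∀ z : ℂ, 0 < z.im → HasDerivAt F (f z) z := by
  induction hf using Submodule.span_induction with
  | mem f hf =>
    obtain ⟨a, b, hab, J, ⟨P, hP, hJ⟩, rfl⟩ := hf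
    obtain ⟨K, hK⟩ := hprim (Polynomial.X ^ (b + 1) * P)
    have hb : ((b : ℂ) + 1) ≠ 0 := Nat.cast_add_one_ne_zero b
    have hKmem : K ∈ polyPrimitive h (s + 1) := by
      refine ⟨_, ?_, hK⟩
      rw [Polynomial.mem_degreeLT] at hP ⊢
      by_cases hP0 : P = 0
      · simp [hP0]
      · rw [Polynomial.degree_eq_natDegree (by simp [hP0]), Polynomial.natDegree_mul (by simp) hP0]
        rw [Polynomial.degree_eq_natDegree hP0] at hP
        norm_cast at hP ⊢
        simp only [Polynomial.natDegree_pow, Polynomial.natDegree_X]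
        omega
    refine ⟨((b : ℂ) + 1)⁻¹ • ((fun z => z ^ (b + 1) * J z) - K), Submodule.smul_mem _ _
      (sub_mem (Submodule.subset_span ⟨a, b + 1, by omega, J, ⟨P, hP, hJ⟩, rfl⟩)
        (Submodule.subset_span ⟨s + 1, 0, by simp, K, hKmem, by simp⟩)), fun z hz => ?_⟩
    refine ((((hasDerivAt_pow (b + 1) z).mul (hJ z hz)).sub (hK z hz)).const_smul
      ((b : ℂ) + 1)⁻¹).congr_deriv ?_
    simp only [Polynomial.eval_mul, Polynomial.eval_pow, Polynomial.eval_X, smul_eq_mul]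
    push_cast
    field_simp
    simp
  | zero => exact ⟨0, zero_mem _, fun z _ => by simp⟩
  | add f g _ _ ihf ihg =>
    obtain ⟨F, hF, hF'⟩ := ihf
    obtain ⟨G, hG, hG'⟩ := ihg
    exact ⟨F + G, add_mem hF hG, fun z hz => (hF' z hz).add (hG' z hz)⟩
  | smul c f _ ihf =>
    obtain ⟨F, hF, hF'⟩ := ihf
    exact ⟨c • F, Submodule.smul_mem _ c hF, fun z hz => (hF' z hz).const_smul c⟩

lemma exists_const_of_hasDerivAt_eq {F G f : ℂ → ℂ}
    (hF : ∀ z : ℂ, 0 < z.im → HasDerivAt F (f z) z)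
    (hG : ∀ z : ℂ, 0 < z.im → HasDerivAt G (f z) z) :
    ∃ c : ℂ, ∀ z : ℂ, 0 < z.im → F z = G z + c := by
  have hpre : IsPreconnected {z : ℂ | 0 < z.im} := (convex_halfSpace_im_gt 0).isPreconnected
  have hopen : IsOpen {z : ℂ | 0 < z.im} := isOpen_lt continuous_const Complex.continuous_im
  obtain ⟨c, hc⟩ := hopen.exists_eq_add_of_deriv_eq hpre
    (fun z hz => (hF z hz).differentiableAt.differentiableWithinAt)
    (fun z hz => (hG z hz).differentiableAt.differentiableWithinAt)
    (fun z hz => by rw [(hF z hz).deriv, (hG z hz).deriv])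
  exact ⟨c, fun z hz => hc hz⟩

/-- Restriction of a function on `ℂ` to the upper half-plane. -/
def restrictUpper : (ℂ → ℂ) →ₗ[ℂ] ({z : ℂ // 0 < z.im} → ℂ) :=
  LinearMap.funLeft ℂ ℂ Subtype.val

lemma finiteDimensional_map_restrictUpper_polyPrimitive {h : ℂ → ℂ}
    (hprim : ∀ P : Polynomial ℂ, ∃ K : ℂ → ℂ, ∀ z : ℂ, 0 < z.im →
      HasDerivAt K (P.eval z * h z) z) (a : ℕ) :
    FiniteDimensional ℂ ((polyPrimitive h a).map restrictUpper) := by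
  choose K hK using fun i : ℕ => hprim (Polynomial.X ^ i)
  have := FiniteDimensional.span_of_finite ℂ (A := insert (fun _ => 1)
    ((fun i => restrictUpper (K i)) '' (Finset.range a : Set ℕ)))
    ((Finset.finite_toSet _).image _ |>.insert _)
  refine Submodule.finiteDimensional_of_le (S₂ := Submodule.span ℂ (insert (fun _ => 1)
    ((fun i => restrictUpper (K i)) '' (Finset.range a : Set ℕ)))) ?_
  rintro _ ⟨J, ⟨P, hP, hJ⟩, rfl⟩
  have hsum : ∀ z : ℂ, 0 < z.im →
      HasDerivAt (∑ i ∈ Finset.range a, P.coeff i • K i) (P.eval z * h z) z := by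
    intro z hz
    refine (HasDerivAt.sum fun i _ => (hK i z hz).const_smul (P.coeff i)).congr_deriv ?_
    rw [Polynomial.eval_eq_sum_degreeLTEquiv hP, Finset.sum_mul,
      ← Fin.sum_univ_eq_sum_range
        (fun i => P.coeff i • (Polynomial.eval z (Polynomial.X ^ i) * h z))]
    simp [Polynomial.degreeLTEquiv, mul_assoc]
  obtain ⟨c, hc⟩ := exists_const_of_hasDerivAt_eq hJ hsum
  have : restrictUpper J = ∑ i ∈ Finset.range a, P.coeff i • restrictUpper (K i) +
      c • (fun _ => (1 : ℂ)) := by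
    ext z
    simp [restrictUpper, LinearMap.funLeft, hc z.1 z.2, Finset.sum_apply]
  rw [this]
  refine add_mem (sum_mem fun i hi => Submodule.smul_mem _ _ (Submodule.subset_span ?_))
    (Submodule.smul_mem _ _ (Submodule.subset_span (Set.mem_insert _ _)))
  exact Set.mem_insert_of_mem _ ⟨i, by simpa using hi, rfl⟩

/-- The denominator `c z + d` of the Möbius action of an integral matrix. -/
noncomputable def moebiusDenom (γ : Matrix.SpecialLinearGroup (Fin 2) ℤ) (z : ℂ) : ℂ :=
  ((γ : Matrix (Fin 2) (Fin 2) ℤ) 1 0 : ℂ) * z + ((γ : Matrix (Fin 2) (Fin 2) ℤ) 1 1 : ℂ)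

/-- The numerator `a z + b` of the Möbius action of an integral matrix. -/
noncomputable def moebiusNum (γ : Matrix.SpecialLinearGroup (Fin 2) ℤ) (z : ℂ) : ℂ :=
  ((γ : Matrix (Fin 2) (Fin 2) ℤ) 0 0 : ℂ) * z + ((γ : Matrix (Fin 2) (Fin 2) ℤ) 0 1 : ℂ)

/-- The weight `-w` slash translate of a function by an integral matrix, on the upper
half-plane. -/
noncomputable def slashTranslate (w : ℕ) (γ : Matrix.SpecialLinearGroup (Fin 2) ℤ) :
    (ℂ → ℂ) →ₗ[ℂ] ({z : ℂ // 0 < z.im} → ℂ) where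
  toFun f := fun τ => moebiusDenom γ τ.1 ^ w * f (moebiusNum γ τ.1 / moebiusDenom γ τ.1)
  map_add' f g := by ext τ; simp [mul_add]
  map_smul' c f := by ext τ; simp [mul_left_comm]

lemma coe_smul_eq_moebius (γ : Matrix.SpecialLinearGroup (Fin 2) ℤ) (z : UpperHalfPlane) :
    ((γ • z : UpperHalfPlane) : ℂ) = moebiusNum γ z / moebiusDenom γ z := by
  rw [UpperHalfPlane.coe_specialLinearGroup_apply]
  simp [moebiusNum, moebiusDenom]

lemma moebiusDenom_ne_zero (γ : Matrix.SpecialLinearGroup (Fin 2) ℤ) {z : ℂ} (hz : 0 < z.im) :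
    moebiusDenom γ z ≠ 0 := by
  have := UpperHalfPlane.denom_ne_zero (γ : GL (Fin 2) ℝ) ⟨z, hz⟩
  simpa [UpperHalfPlane.denom, moebiusDenom] using this

lemma moebius_im_pos (γ : Matrix.SpecialLinearGroup (Fin 2) ℤ) {z : ℂ} (hz : 0 < z.im) :
    0 < (moebiusNum γ z / moebiusDenom γ z).im := by
  have := (γ • (⟨z, hz⟩ : UpperHalfPlane)).im_pos
  rwa [← UpperHalfPlane.coe_im, coe_smul_eq_moebius] at this

lemma hasDerivAt_moebius (γ : Matrix.SpecialLinearGroup (Fin 2) ℤ) {z : ℂ} (hz : 0 < z.im) :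
    HasDerivAt (fun z => moebiusNum γ z / moebiusDenom γ z) (1 / moebiusDenom γ z ^ 2) z := by
  have hdet : ((γ : Matrix (Fin 2) (Fin 2) ℤ) 0 0 : ℂ) * (γ : Matrix (Fin 2) (Fin 2) ℤ) 1 1 -
      ((γ : Matrix (Fin 2) (Fin 2) ℤ) 0 1 : ℂ) * (γ : Matrix (Fin 2) (Fin 2) ℤ) 1 0 = 1 := by
    have := γ.det_coe
    rw [Matrix.det_fin_two] at this
    exact_mod_cast this
  have hlin : ∀ a b : ℂ, HasDerivAt (fun z => a * z + b) a z := fun a b => by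
    simpa using ((hasDerivAt_id z).const_mul a).add_const b
  refine ((hlin _ _).div (hlin _ _) (moebiusDenom_ne_zero γ hz)).congr_deriv ?_
  change _ / moebiusDenom γ z ^ 2 = _
  congr 1
  linear_combination hdet

open Polynomial in
lemma exists_polynomial_moebius (γ : Matrix.SpecialLinearGroup (Fin 2) ℤ) {m : ℕ}
    {P : ℂ[X]} (hP : P ∈ degreeLT ℂ (m + 1)) :
    ∃ Q ∈ degreeLT ℂ (m + 1), ∀ z : ℂ, 0 < z.im →
      moebiusDenom γ z ^ m * P.eval (moebiusNum γ z / moebiusDenom γ z) = Q.eval z := by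
  let A : ℂ[X] := C ((γ : Matrix (Fin 2) (Fin 2) ℤ) 0 0 : ℂ) * X +
    C ((γ : Matrix (Fin 2) (Fin 2) ℤ) 0 1 : ℂ)
  let B : ℂ[X] := C ((γ : Matrix (Fin 2) (Fin 2) ℤ) 1 0 : ℂ) * X +
    C ((γ : Matrix (Fin 2) (Fin 2) ℤ) 1 1 : ℂ)
  have hA : A.natDegree ≤ 1 := natDegree_linear_le
  have hB : B.natDegree ≤ 1 := natDegree_linear_le
  refine ⟨∑ i ∈ Finset.range (m + 1), P.coeff i • (A ^ i * B ^ (m - i)),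
    sum_mem fun i hi => Submodule.smul_mem _ _ ?_, fun z hz => ?_⟩
  · have hi' : i ≤ m := Nat.lt_succ_iff.mp (Finset.mem_range.mp hi)
    have hle : (A ^ i * B ^ (m - i)).natDegree ≤ m := by
      have h1 := natDegree_pow_le_of_le i hA
      have h2 := natDegree_pow_le_of_le (m - i) hB
      have h3 := natDegree_mul_le_of_le h1 h2
      omega
    rw [mem_degreeLT]
    exact (degree_le_of_natDegree_le hle).trans_lt (by exact_mod_cast Nat.lt_succ_self m)
  · have hz' := moebiusDenom_ne_zero γ hz
    have hPdeg : P.natDegree < m + 1 := by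
      rw [mem_degreeLT] at hP
      by_cases hP0 : P = 0
      · simp [hP0]
      · exact (natDegree_lt_iff_degree_lt hP0).mpr hP
    rw [eval_eq_sum_range' hPdeg, Finset.mul_sum, eval_finsetSum]
    refine Finset.sum_congr rfl fun i hi => ?_
    obtain ⟨j, rfl⟩ := Nat.exists_eq_add_of_le (Nat.lt_succ_iff.mp (Finset.mem_range.mp hi))
    have hAz : A.eval z = moebiusNum γ z := by simp [A, moebiusNum]
    have hBz : B.eval z = moebiusDenom γ z := by simp [B, moebiusDenom]
    rw [eval_smul, eval_mul, eval_pow, eval_pow, hAz, hBz, Nat.add_sub_cancel_left, div_pow,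
      pow_add, smul_eq_mul]
    field_simp

lemma comp_moebius_mem_polyPrimitive {h : ℂ → ℂ} {m : ℕ}
    (γ : Matrix.SpecialLinearGroup (Fin 2) ℤ)
    (hmod : ∀ z : ℂ, 0 < z.im →
      h (moebiusNum γ z / moebiusDenom γ z) = moebiusDenom γ z ^ (m + 2) * h z)
    {J : ℂ → ℂ} (hJ : J ∈ polyPrimitive h (m + 1)) :
    (fun z => J (moebiusNum γ z / moebiusDenom γ z)) ∈ polyPrimitive h (m + 1) := by
  obtain ⟨P, hP, hJ⟩ := hJ
  obtain ⟨Q, hQ, hPQ⟩ := exists_polynomial_moebius γ hP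
  refine ⟨Q, hQ, fun z hz => ?_⟩
  refine ((hJ _ (moebius_im_pos γ hz)).comp z (hasDerivAt_moebius γ hz)).congr_deriv ?_
  have hz' := moebiusDenom_ne_zero γ hz
  rw [hmod z hz, ← hPQ z hz]
  field_simp
  ring

/-- Polynomial functions of degree at most `w` on the upper half-plane. -/
noncomputable def polyUpper (w : ℕ) : Submodule ℂ ({z : ℂ // 0 < z.im} → ℂ) :=
  (Polynomial.degreeLT ℂ (w + 1)).map (LinearMap.pi fun τ => Polynomial.leval τ.1)

lemma slashTranslate_mem {h : ℂ → ℂ} {m w s : ℕ} (hsw : s ≤ w) (hsm : s ≤ m + 1)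
    (γ : Matrix.SpecialLinearGroup (Fin 2) ℤ)
    (hmod : ∀ z : ℂ, 0 < z.im →
      h (moebiusNum γ z / moebiusDenom γ z) = moebiusDenom γ z ^ (m + 2) * h z)
    {f : ℂ → ℂ} (hf : f ∈ iteratedPrimitive h s) :
    slashTranslate w γ f ∈ polyUpper w * (polyPrimitive h (m + 1)).map restrictUpper := by
  rw [← Submodule.mem_comap]
  refine Submodule.span_le.mpr ?_ hf
  rintro _ ⟨a, b, hab, J, hJ, rfl⟩
  have hJ' := comp_moebius_mem_polyPrimitive γ hmod (polyPrimitive_mono h (by omega) hJ)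
  have hb : (Polynomial.X ^ b : Polynomial ℂ) ∈ Polynomial.degreeLT ℂ (w + 1) := by
    rw [Polynomial.mem_degreeLT, Polynomial.degree_X_pow]
    exact_mod_cast (by omega : b < w + 1)
  obtain ⟨Q, hQ, hPQ⟩ := exists_polynomial_moebius γ hb
  have : slashTranslate w γ (fun z => z ^ b * J z) =
      (LinearMap.pi fun τ : {z : ℂ // 0 < z.im} => Polynomial.leval τ.1) Q *
        restrictUpper (fun z => J (moebiusNum γ z / moebiusDenom γ z)) := by
    ext τ
    have := hPQ τ.1 τ.2
    simp only [Polynomial.eval_pow, Polynomial.eval_X] at this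
    simp [slashTranslate, restrictUpper, LinearMap.funLeft, ← this, mul_assoc]
  simp only [SetLike.mem_coe, Submodule.mem_comap]
  rw [this]
  exact Submodule.mul_mem_mul ⟨Q, hQ, rfl⟩ ⟨_, hJ', rfl⟩

lemma finiteDimensional_polyUpper_mul {h : ℂ → ℂ}
    (hprim : ∀ P : Polynomial ℂ, ∃ K : ℂ → ℂ, ∀ z : ℂ, 0 < z.im →
      HasDerivAt K (P.eval z * h z) z) (w a : ℕ) :
    FiniteDimensional ℂ
      ↥(polyUpper w * (polyPrimitive h a).map restrictUpper) := by
  have h1 := finiteDimensional_map_restrictUpper_polyPrimitive hprim a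
  have h2 : FiniteDimensional ℂ (polyUpper w) := by unfold polyUpper; infer_instance
  rw [FiniteDimensional, Module.Finite.iff_fg] at h1 h2 ⊢
  exact h2.mul h1

/-- The Lambert-type series `∑ p ^ e (m p) ^ (-s) q ^ (m p)` over `m, p ≥ 1`: the `s`-fold
primitive of the non-constant part of the Eisenstein series of weight `e + 1`. -/
noncomputable def lambertSeries (e s : ℕ) (τ : ℂ) : ℂ :=
  ∑' mp : ℕ × ℕ, ((mp.2 : ℂ) + 1) ^ e / (((mp.1 : ℂ) + 1) * ((mp.2 : ℂ) + 1)) ^ s *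
    Complex.exp (2 * ↑π * Complex.I * τ) ^ ((mp.1 + 1) * (mp.2 + 1))

lemma summable_pow_mul_pow_mul {x : ℝ} (hx0 : 0 ≤ x) (hx : x < 1) (e : ℕ) :
    Summable fun mp : ℕ × ℕ => ((mp.2 : ℝ) + 1) ^ e * x ^ ((mp.1 + 1) * (mp.2 + 1)) := by
  have h := summable_prod_mul_pow (𝕜 := ℝ) e (r := x) (by rwa [Real.norm_of_nonneg hx0])
  have h' := (Equiv.prodCongr Equiv.pnatEquivNat Equiv.pnatEquivNat).symm.summable_iff.mpr h
  refine h'.congr fun mp => ?_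
  simp [Equiv.pnatEquivNat]

lemma norm_exp_two_pi_I_mul (τ : ℂ) :
    ‖Complex.exp (2 * ↑π * Complex.I * τ)‖ = Real.exp (-(2 * π * τ.im)) := by
  rw [Complex.norm_exp]
  simp

lemma norm_lambert_term_le (e s : ℕ) (mp : ℕ × ℕ) {τ : ℂ} {x : ℝ}
    (hx : ‖Complex.exp (2 * ↑π * Complex.I * τ)‖ ≤ x) :
    ‖((mp.2 : ℂ) + 1) ^ e / (((mp.1 : ℂ) + 1) * ((mp.2 : ℂ) + 1)) ^ s *
      Complex.exp (2 * ↑π * Complex.I * τ) ^ ((mp.1 + 1) * (mp.2 + 1))‖ ≤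
      ((mp.2 : ℝ) + 1) ^ e * x ^ ((mp.1 + 1) * (mp.2 + 1)) := by
  have hcast : ∀ a : ℕ, ‖(a : ℂ) + 1‖ = (a : ℝ) + 1 := fun a => by
    rw [← Nat.cast_add_one, Complex.norm_natCast, Nat.cast_add_one]
  rw [norm_mul, norm_div, norm_pow, norm_pow, norm_pow, norm_mul, hcast, hcast]
  have h1 : (1 : ℝ) ≤ (((mp.1 : ℝ) + 1) * ((mp.2 : ℝ) + 1)) ^ s := by
    apply one_le_pow₀
    nlinarith [Nat.cast_nonneg (α := ℝ) mp.1, Nat.cast_nonneg (α := ℝ) mp.2,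
      mul_nonneg (Nat.cast_nonneg (α := ℝ) mp.1) (Nat.cast_nonneg (α := ℝ) mp.2)]
  gcongr
  exact div_le_self (by positivity) h1

lemma summable_lambertSeries (e s : ℕ) {τ : ℂ} (hτ : 0 < τ.im) :
    Summable fun mp : ℕ × ℕ =>
      ((mp.2 : ℂ) + 1) ^ e / (((mp.1 : ℂ) + 1) * ((mp.2 : ℂ) + 1)) ^ s *
        Complex.exp (2 * ↑π * Complex.I * τ) ^ ((mp.1 + 1) * (mp.2 + 1)) := by
  refine Summable.of_norm_bounded (summable_pow_mul_pow_mul (norm_nonneg _) ?_ e)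
    fun mp => norm_lambert_term_le e s mp le_rfl
  rw [norm_exp_two_pi_I_mul, Real.exp_lt_one_iff]
  have := Real.pi_pos
  have := mul_pos this hτ
  linarith

lemma hasDerivAt_lambert_term (e s : ℕ) (mp : ℕ × ℕ) (z : ℂ) :
    HasDerivAt (fun z : ℂ =>
      ((mp.2 : ℂ) + 1) ^ e / (((mp.1 : ℂ) + 1) * ((mp.2 : ℂ) + 1)) ^ (s + 1) *
        Complex.exp (2 * ↑π * Complex.I * z) ^ ((mp.1 + 1) * (mp.2 + 1)))
      (2 * ↑π * Complex.I *
        (((mp.2 : ℂ) + 1) ^ e / (((mp.1 : ℂ) + 1) * ((mp.2 : ℂ) + 1)) ^ s *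
          Complex.exp (2 * ↑π * Complex.I * z) ^ ((mp.1 + 1) * (mp.2 + 1)))) z := by
  have h1 : HasDerivAt (fun z : ℂ => Complex.exp (2 * ↑π * Complex.I * z))
      (Complex.exp (2 * ↑π * Complex.I * z) * (2 * ↑π * Complex.I)) z := by
    simpa using ((hasDerivAt_id z).const_mul (2 * ↑π * Complex.I)).cexp
  refine ((h1.fun_pow ((mp.1 + 1) * (mp.2 + 1))).const_mul _).congr_deriv ?_
  obtain ⟨N, hN⟩ : ∃ N, (mp.1 + 1) * (mp.2 + 1) = N + 1 :=
    Nat.exists_eq_succ_of_ne_zero (by positivity)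
  have hN' : ((mp.1 : ℂ) + 1) * ((mp.2 : ℂ) + 1) = N + 1 := by exact_mod_cast hN
  have hN0 : (N : ℂ) + 1 ≠ 0 := Nat.cast_add_one_ne_zero _
  rw [hN, hN', Nat.add_sub_cancel]
  push_cast
  field_simp
  ring

lemma hasDerivAt_lambertSeries (e s : ℕ) {τ : ℂ} (hτ : 0 < τ.im) :
    HasDerivAt (lambertSeries e (s + 1)) (2 * ↑π * Complex.I * lambertSeries e s τ) τ := by
  have hx1 : Real.exp (-(2 * π * (τ.im / 2))) < 1 := by
    rw [Real.exp_lt_one_iff]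
    have := mul_pos Real.pi_pos hτ
    linarith
  have hmem : τ ∈ {z : ℂ | τ.im / 2 < z.im} := half_lt_self hτ
  have hsum := (summable_pow_mul_pow_mul (Real.exp_pos _).le hx1 e).mul_left (2 * π)
  have key := hasDerivAt_tsum_of_isPreconnected hsum
    (isOpen_lt continuous_const Complex.continuous_im)
    (convex_halfSpace_im_gt _).isPreconnected
    (fun mp z _ => hasDerivAt_lambert_term e s mp z) (fun mp z hz => ?_) hmem
    (summable_lambertSeries e (s + 1) hτ) hmem
  · rw [tsum_mul_left] at key
    exact key
  · have h2 : ‖(2 * ↑π * Complex.I : ℂ)‖ = 2 * π := by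
      simp [abs_of_pos Real.pi_pos]
    rw [norm_mul, h2]
    refine mul_le_mul_of_nonneg_left (norm_lambert_term_le e s mp ?_) (by positivity)
    rw [norm_exp_two_pi_I_mul]
    have : τ.im / 2 < z.im := hz
    have := Real.pi_pos
    gcongr

open Polynomial in
lemma exists_primitive_mul_lambertSeries (e : ℕ) (P : ℂ[X]) (s : ℕ) :
    ∃ K : ℂ → ℂ, ∀ z : ℂ, 0 < z.im → HasDerivAt K (P.eval z * lambertSeries e s z) z := by
  have h2 : (2 * ↑π * Complex.I : ℂ) ≠ 0 := Complex.two_pi_I_ne_zero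
  induction hn : P.natDegree using Nat.strong_induction_on generalizing P s with
  | _ n ih =>
    subst hn
    have hparts : ∀ Q : ℂ → ℂ, (∀ z : ℂ, 0 < z.im →
        HasDerivAt Q (P.derivative.eval z * lambertSeries e (s + 1) z) z) →
        ∀ z : ℂ, 0 < z.im → HasDerivAt
          ((2 * ↑π * Complex.I : ℂ)⁻¹ • ((fun z => P.eval z * lambertSeries e (s + 1) z) - Q))
          (P.eval z * lambertSeries e s z) z := by
      intro Q hQ z hz
      refine ((((P.hasDerivAt z).mul (hasDerivAt_lambertSeries e s hz)).sub
        (hQ z hz)).const_smul _).congr_deriv ?_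
      simp only [smul_eq_mul]
      field_simp
      ring
    by_cases hP : P.natDegree = 0
    · exact ⟨_, hparts 0 fun z _ => by
        rw [derivative_of_natDegree_zero hP]
        simp⟩
    · obtain ⟨Q, hQ⟩ := ih _ (natDegree_derivative_lt hP) P.derivative (s + 1) rfl
      exact ⟨_, hparts Q hQ⟩

lemma exists_primitive_polynomial (P : Polynomial ℂ) :
    ∃ K : ℂ → ℂ, ∀ z : ℂ, HasDerivAt K (P.eval z) z := by
  refine ⟨fun z => ∑ i ∈ Finset.range (P.natDegree + 1),
    P.coeff i / (i + 1) * z ^ (i + 1), fun z => ?_⟩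
  rw [Polynomial.eval_eq_sum_range]
  refine HasDerivAt.fun_sum fun i _ => ?_
  refine ((hasDerivAt_pow (i + 1) z).const_mul _).congr_deriv ?_
  have : (i : ℂ) + 1 ≠ 0 := Nat.cast_add_one_ne_zero i
  push_cast
  field_simp

lemma exists_primitive_mul_add_lambertSeries (c : ℂ) (e : ℕ) (P : Polynomial ℂ) :
    ∃ K : ℂ → ℂ, ∀ z : ℂ, 0 < z.im →
      HasDerivAt K (P.eval z * (1 + c * lambertSeries e 0 z)) z := by
  obtain ⟨K₁, h₁⟩ := exists_primitive_polynomial P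
  obtain ⟨K₂, h₂⟩ := exists_primitive_mul_lambertSeries e P 0
  refine ⟨K₁ + c • K₂, fun z hz => ((h₁ z).add ((h₂ z hz).const_smul c)).congr_deriv ?_⟩
  simp only [smul_eq_mul]
  ring

lemma exists_mem_iteratedPrimitive_eq_lambertSeries {c : ℂ} (hc : c ≠ 0) (e s : ℕ) :
    ∃ F ∈ iteratedPrimitive (fun z => 1 + c * lambertSeries e 0 z) (s + 1),
      ∀ z : ℂ, 0 < z.im → lambertSeries e (s + 1) z = F z := by
  set h : ℂ → ℂ := fun z => 1 + c * lambertSeries e 0 z with hh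
  have key : ∀ (s : ℕ) (G : ℂ → ℂ), G ∈ iteratedPrimitive h (s + 1) →
      (∀ z : ℂ, 0 < z.im → HasDerivAt G (2 * ↑π * Complex.I * lambertSeries e s z) z) →
      ∃ F ∈ iteratedPrimitive h (s + 1), ∀ z : ℂ, 0 < z.im → lambertSeries e (s + 1) z = F z := by
    intro s G hG hG'
    obtain ⟨d, hd⟩ := exists_const_of_hasDerivAt_eq
      (fun z hz => hasDerivAt_lambertSeries e s hz) hG'
    exact ⟨G + fun _ => d, add_mem hG (const_mem_iteratedPrimitive h _ d), hd⟩
  induction s with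
  | zero =>
    obtain ⟨K, hK⟩ := exists_primitive_mul_add_lambertSeries c e 1
    have hK' : K ∈ polyPrimitive h 1 := ⟨1, by simp [Polynomial.mem_degreeLT], hK⟩
    refine key 0 ((2 * ↑π * Complex.I / c) • (K - fun z => z)) (Submodule.smul_mem _ _ (sub_mem
      (Submodule.subset_span ⟨1, 0, rfl, K, hK', by simp⟩)
      (Submodule.subset_span ⟨0, 1, rfl, _, const_mem_polyPrimitive h 0 1, by simp⟩)))
      fun z hz => (((hK z hz).sub (hasDerivAt_id' z)).const_smul _).congr_deriv ?_
    simp only [Polynomial.eval_one, smul_eq_mul]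
    field_simp
    ring
  | succ s ih =>
    obtain ⟨f, hf, hfs⟩ := ih
    obtain ⟨F, hF, hF'⟩ := exists_primitive_mem_iteratedPrimitive
      (exists_primitive_mul_add_lambertSeries c e) hf
    refine key (s + 1) ((2 * ↑π * Complex.I : ℂ) • F) (Submodule.smul_mem _ _ hF) fun z hz => ?_
    rw [hfs z hz]
    exact (hF' z hz).const_smul _

lemma lambertSeries_zero_eq (e : ℕ) (z : UpperHalfPlane) :
    lambertSeries e 0 z =
      ∑' n : ℕ+, (ArithmeticFunction.sigma e n : ℂ) *
        Complex.exp (2 * ↑π * Complex.I * z) ^ (n : ℕ) := by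
  have hq := UpperHalfPlane.norm_exp_two_pi_I_lt_one z
  rw [← tsum_prod_pow_eq_tsum_sigma e hq, ← (summable_prod_mul_pow e hq).tsum_prod,
    ← (Equiv.prodCongr Equiv.pnatEquivNat Equiv.pnatEquivNat).symm.tsum_eq, lambertSeries]
  refine tsum_congr fun mp => ?_
  simp [Equiv.pnatEquivNat]

/-- `1 + c ∑ σ_{m+1}(N) q ^ N` is modular of weight `m + 2` for a suitable non-zero `c`. -/
lemma exists_modular_lambertSeries {m : ℕ} (hm : 1 ≤ m) (hm2 : Even m) :
    ∃ c : ℂ, c ≠ 0 ∧ ∀ (γ : Matrix.SpecialLinearGroup (Fin 2) ℤ) (z : ℂ), 0 < z.im →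
      1 + c * lambertSeries (m + 1) 0 (moebiusNum γ z / moebiusDenom γ z) =
        moebiusDenom γ z ^ (m + 2) * (1 + c * lambertSeries (m + 1) 0 z) := by
  have hk : 3 ≤ m + 2 := by omega
  have hE : ∀ z : UpperHalfPlane, ModularForm.E hk z = 1 + ((riemannZeta ((m + 2 : ℕ) : ℂ))⁻¹ *
      (-2 * π * Complex.I) ^ (m + 2) / (m + 2 - 1)!) * lambertSeries (m + 1) 0 z := fun z => by
    rw [EisensteinSeries.q_expansion_riemannZeta hk (hm2.add (by decide)), lambertSeries_zero_eq]
    simp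
  have hzeta : riemannZeta ((m + 2 : ℕ) : ℂ) ≠ 0 :=
    riemannZeta_ne_zero_of_one_lt_re (by norm_cast; omega)
  refine ⟨(riemannZeta ((m + 2 : ℕ) : ℂ))⁻¹ * (-2 * π * Complex.I) ^ (m + 2) / (m + 2 - 1)!,
    ?_, fun γ z hz => ?_⟩
  · have hpi : (π : ℂ) ≠ 0 := by exact_mod_cast Real.pi_ne_zero
    have hfac : ((m + 2 - 1)! : ℂ) ≠ 0 := by exact_mod_cast Nat.factorial_ne_zero _
    refine div_ne_zero (mul_ne_zero (inv_ne_zero hzeta) (pow_ne_zero _ ?_)) hfac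
    simp [hpi]
  · have h1 := hE (γ • ⟨z, hz⟩)
    have h2 := hE ⟨z, hz⟩
    rw [coe_smul_eq_moebius] at h1
    have hγ : (γ : GL (Fin 2) ℝ) ∈ (Matrix.SpecialLinearGroup.mapGL ℝ).range := ⟨γ, rfl⟩
    have h3 := SlashInvariantForm.slash_action_eqn'' (ModularForm.E hk) hγ ⟨z, hz⟩
    have h4 : UpperHalfPlane.denom (γ : GL (Fin 2) ℝ) ((⟨z, hz⟩ : UpperHalfPlane) : ℂ) =
        moebiusDenom γ z := by
      simp [UpperHalfPlane.denom, moebiusDenom]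
    rw [h4] at h3
    rw [← h1, ← h2]
    exact_mod_cast h3

lemma exists_integral_pow_mul_exp (R : ℕ) :
    ∃ d : ℕ → ℂ, ∀ m : ℤ, m ≠ 0 →
      ∫ t in (0 : ℝ)..1, (2 * ↑π * Complex.I * (t : ℂ)) ^ R / (R ! : ℂ) *
        Complex.exp (2 * ↑π * Complex.I * m * t) =
      ∑ i ∈ Finset.range R, d i / (m : ℂ) ^ (i + 1) := by
  have h2 : (2 * ↑π * Complex.I : ℂ) ≠ 0 := Complex.two_pi_I_ne_zero
  have hexp : ∀ m : ℤ, Complex.exp (2 * ↑π * Complex.I * m) = 1 := fun m => by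
    rw [mul_comm]; exact Complex.exp_int_mul_two_pi_mul_I m
  have hprim : ∀ m : ℤ, m ≠ 0 → ∀ t : ℝ, HasDerivAt
      (fun t : ℝ => Complex.exp (2 * ↑π * Complex.I * m * t) / (2 * ↑π * Complex.I * m))
      (Complex.exp (2 * ↑π * Complex.I * m * t)) t := fun m hm t => by
    have hm' : (m : ℂ) ≠ 0 := Int.cast_ne_zero.mpr hm
    have h1 : HasDerivAt (fun t : ℝ => 2 * ↑π * Complex.I * m * (t : ℂ))
        (2 * ↑π * Complex.I * m) t := by
      simpa using (Complex.ofRealCLM.hasDerivAt (x := t)).const_mul (2 * ↑π * Complex.I * m)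
    exact (h1.cexp.div_const _).congr_deriv (by field_simp)
  induction R with
  | zero =>
    refine ⟨0, fun m hm => ?_⟩
    have := intervalIntegral.integral_eq_sub_of_hasDerivAt (a := 0) (b := 1)
      (fun t _ => hprim m hm t) (Continuous.intervalIntegrable (by fun_prop) _ _)
    simpa [hexp] using this
  | succ R ih =>
    obtain ⟨d, hd⟩ := ih
    refine ⟨fun i => i.casesOn ((2 * ↑π * Complex.I) ^ R / ((R + 1)! : ℂ)) fun j => -d j,
      fun m hm => ?_⟩
    have hm' : (m : ℂ) ≠ 0 := Int.cast_ne_zero.mpr hm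
    have hfac : (R ! : ℂ) ≠ 0 := by exact_mod_cast Nat.factorial_ne_zero R
    have hu : ∀ t : ℝ, HasDerivAt
        (fun t : ℝ => (2 * ↑π * Complex.I * (t : ℂ)) ^ (R + 1) / ((R + 1)! : ℂ))
        (2 * ↑π * Complex.I * ((2 * ↑π * Complex.I * (t : ℂ)) ^ R / (R ! : ℂ))) t := fun t => by
      have h1 : HasDerivAt (fun t : ℝ => 2 * ↑π * Complex.I * (t : ℂ))
          (2 * ↑π * Complex.I) t := by
        simpa using (Complex.ofRealCLM.hasDerivAt (x := t)).const_mul (2 * ↑π * Complex.I)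
      refine ((h1.fun_pow (R + 1)).div_const _).congr_deriv ?_
      rw [Nat.factorial_succ, Nat.add_sub_cancel]
      push_cast
      field_simp
    rw [intervalIntegral.integral_mul_deriv_eq_deriv_mul (fun t _ => hu t)
      (fun t _ => hprim m hm t) (Continuous.intervalIntegrable (by fun_prop) _ _)
      (Continuous.intervalIntegrable (by fun_prop) _ _), Finset.sum_range_succ']
    have hI : ∫ t in (0 : ℝ)..1,
        2 * ↑π * Complex.I * ((2 * ↑π * Complex.I * (t : ℂ)) ^ R / (R ! : ℂ)) *
          (Complex.exp (2 * ↑π * Complex.I * m * t) / (2 * ↑π * Complex.I * m)) =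
        (m : ℂ)⁻¹ * ∑ i ∈ Finset.range R, d i / (m : ℂ) ^ (i + 1) := by
      rw [← hd m hm, ← intervalIntegral.integral_const_mul]
      congr 1
      ext t
      field_simp
    rw [hI, Finset.mul_sum]
    have hsum : ∑ i ∈ Finset.range R, -d i / (m : ℂ) ^ (i + 1 + 1) =
        -∑ i ∈ Finset.range R, (m : ℂ)⁻¹ * (d i / (m : ℂ) ^ (i + 1)) := by
      rw [← Finset.sum_neg_distrib]
      refine Finset.sum_congr rfl fun i _ => ?_
      field_simp
      ring
    have hbdry : (2 * ↑π * Complex.I) ^ (R + 1) / ((R + 1)! : ℂ) *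
        (1 / (2 * ↑π * Complex.I * m)) =
        (2 * ↑π * Complex.I) ^ R / ((R + 1)! : ℂ) / (m : ℂ) ^ (0 + 1) := by
      field_simp
      ring
    simp only [hsum, Complex.ofReal_one, mul_one, hexp, Complex.ofReal_zero, mul_zero,
      Complex.exp_zero, zero_pow R.succ_ne_zero, zero_div, zero_mul, sub_zero, hbdry]
    exact sub_eq_neg_add _ _

lemma exists_integral_pow_mul_exp_add_exp (R ν : ℕ) :
    ∃ e : ℕ → ℂ, (∀ i, ¬ Even (ν + 1 + i) → e i = 0) ∧ ∀ m : ℕ,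
      ∫ t in (0 : ℝ)..1, (2 * ↑π * Complex.I * (t : ℂ)) ^ R / (R ! : ℂ) *
        (Complex.exp (2 * ↑π * Complex.I * ((m : ℂ) + 1) * t) + (-1 : ℂ) ^ (ν + 2) *
          Complex.exp (-(2 * ↑π * Complex.I * ((m : ℂ) + 1) * t))) =
      ∑ i ∈ Finset.range R, e i / ((m : ℂ) + 1) ^ (i + 1) := by
  obtain ⟨d, hd⟩ := exists_integral_pow_mul_exp R
  refine ⟨fun i => d i * (1 + (-1) ^ (ν + 1 + i)), fun i hi => ?_, fun m => ?_⟩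
  · rw [Nat.not_even_iff_odd] at hi
    simp [hi.neg_one_pow]
  · have h1 := hd (m + 1) (by omega)
    have h2 := hd (-(m + 1)) (by omega)
    push_cast at h1 h2
    have hm : (m : ℂ) + 1 ≠ 0 := Nat.cast_add_one_ne_zero m
    have hsplit : ∀ t : ℝ, (2 * ↑π * Complex.I * (t : ℂ)) ^ R / (R ! : ℂ) *
        (Complex.exp (2 * ↑π * Complex.I * ((m : ℂ) + 1) * t) + (-1 : ℂ) ^ (ν + 2) *
          Complex.exp (-(2 * ↑π * Complex.I * ((m : ℂ) + 1) * t))) =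
        (2 * ↑π * Complex.I * (t : ℂ)) ^ R / (R ! : ℂ) *
          Complex.exp (2 * ↑π * Complex.I * ((m : ℂ) + 1) * t) +
        (-1 : ℂ) ^ (ν + 2) * ((2 * ↑π * Complex.I * (t : ℂ)) ^ R / (R ! : ℂ) *
          Complex.exp (2 * ↑π * Complex.I * -((m : ℂ) + 1) * t)) := fun t => by
      rw [mul_neg, neg_mul]
      ring
    simp_rw [hsplit]
    rw [intervalIntegral.integral_add (Continuous.intervalIntegrable (by fun_prop) _ _)
      (Continuous.intervalIntegrable (by fun_prop) _ _), intervalIntegral.integral_const_mul,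
      h1, h2, Finset.mul_sum, ← Finset.sum_add_distrib]
    refine Finset.sum_congr rfl fun i _ => ?_
    rw [neg_pow ((m : ℂ) + 1)]
    rcases Nat.even_or_odd i with hi | hi <;> rcases Nat.even_or_odd ν with hν | hν <;>
      simp [pow_add, hi.neg_one_pow, hν.neg_one_pow, div_neg] <;> ring

lemma norm_exp_add_exp_le (ν m : ℕ) (t : ℝ) :
    ‖Complex.exp (2 * ↑π * Complex.I * ((m : ℂ) + 1) * t) + (-1 : ℂ) ^ (ν + 2) *
      Complex.exp (-(2 * ↑π * Complex.I * ((m : ℂ) + 1) * t))‖ ≤ 2 := by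
  refine (norm_add_le _ _).trans ?_
  rw [norm_mul, norm_pow, Complex.norm_exp, Complex.norm_exp]
  simp
  norm_num

lemma exists_AellDepthOne_eq (ν R : ℕ) :
    ∃ (C : ℂ) (e : ℕ → ℂ), (∀ i, ¬ Even (ν + 1 + i) → e i = 0) ∧ ∀ τ : ℂ, 0 < τ.im →
      AellDepthOne (ν + 2) (R + 1) τ =
        C + ∑ i ∈ Finset.range R, e i * lambertSeries (ν + 2 + i) (i + 1) τ := by
  obtain ⟨e, he, hint⟩ := exists_integral_pow_mul_exp_add_exp R ν
  set A : ℂ := 2 * ↑π * Complex.I / ((ν + 1)! : ℂ) with hA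
  set B : ℂ := (bernoulli (ν + 2) : ℂ) / ((ν : ℂ) + 2) with hB
  refine ⟨∫ t in (0 : ℝ)..1, (2 * ↑π * Complex.I * (t : ℂ)) ^ R / (R ! : ℂ) * (A * B),
    fun i => -A * e i, fun i hi => by simp [he i hi], fun τ hτ => ?_⟩
  have hx1 : ‖Complex.exp (2 * ↑π * Complex.I * τ)‖ < 1 := by
    rw [norm_exp_two_pi_I_mul, Real.exp_lt_one_iff]
    have := mul_pos Real.pi_pos hτ
    linarith
  let g : ℕ × ℕ → ℝ → ℂ := fun mp t =>
    (Complex.exp (2 * ↑π * Complex.I * ((mp.1 : ℂ) + 1) * t) + (-1 : ℂ) ^ (ν + 2) *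
      Complex.exp (-(2 * ↑π * Complex.I * ((mp.1 : ℂ) + 1) * t))) *
      ((mp.2 : ℂ) + 1) ^ (ν + 1) *
      Complex.exp (2 * ↑π * Complex.I * τ) ^ ((mp.1 + 1) * (mp.2 + 1))
  let w : ℝ → ℂ := fun t => (2 * ↑π * Complex.I * (t : ℂ)) ^ R / (R ! : ℂ)
  let u : ℕ × ℕ → ℝ := fun mp => 2 * (((mp.2 : ℝ) + 1) ^ (ν + 1) *
    ‖Complex.exp (2 * ↑π * Complex.I * τ)‖ ^ ((mp.1 + 1) * (mp.2 + 1)))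
  have hu : Summable u := (summable_pow_mul_pow_mul (norm_nonneg _) hx1 (ν + 1)).mul_left 2
  have hgu : ∀ mp t, ‖g mp t‖ ≤ u mp := fun mp t => by
    have hcast : ‖(mp.2 : ℂ) + 1‖ = (mp.2 : ℝ) + 1 := by
      rw [← Nat.cast_add_one, Complex.norm_natCast, Nat.cast_add_one]
    simp only [g, u]
    rw [norm_mul, norm_mul, norm_pow, norm_pow, hcast, mul_assoc]
    exact mul_le_mul_of_nonneg_right (norm_exp_add_exp_le ν mp.1 t) (by positivity)
  have hgc : ∀ mp, Continuous (g mp) := fun mp => by fun_prop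
  have hwc : Continuous w := by fun_prop
  have hG : Continuous fun t => ∑' mp, g mp t := continuous_tsum hgc hu hgu
  have hAell : AellDepthOne (ν + 2) (R + 1) τ =
      ∫ t in (0 : ℝ)..1, (w t * (A * B) - A * (w t * ∑' mp, g mp t)) := by
    rw [intervalIntegral.integral_of_le zero_le_one, integral_Ioc_eq_integral_Ioo, AellDepthOne]
    congr 1
    ext t
    simp only [fKr, Nat.add_sub_cancel, w, g, hA, hB]
    ring
  have hsum : HasSum (fun mp => ∫ t in (0 : ℝ)..1, w t * g mp t)
      (∫ t in (0 : ℝ)..1, w t * ∑' mp, g mp t) := by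
    refine intervalIntegral.hasSum_integral_of_dominated_convergence (fun mp t => ‖w t‖ * u mp)
      (fun mp => (hwc.mul (hgc mp)).aestronglyMeasurable) (fun mp => .of_forall fun t _ => ?_)
      (.of_forall fun t _ => hu.mul_left _) ?_ (.of_forall fun t _ => ?_)
    · rw [norm_mul]
      exact mul_le_mul_of_nonneg_left (hgu mp t) (norm_nonneg _)
    · simp_rw [tsum_mul_left]
      exact (hwc.norm.mul continuous_const).intervalIntegrable _ _
    · exact (Summable.of_norm_bounded hu fun mp => hgu mp t).hasSum.mul_left _
  have hterm : ∀ mp : ℕ × ℕ, ∫ t in (0 : ℝ)..1, w t * g mp t =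
      ∑ i ∈ Finset.range R, e i *
        (((mp.2 : ℂ) + 1) ^ (ν + 2 + i) / (((mp.1 : ℂ) + 1) * ((mp.2 : ℂ) + 1)) ^ (i + 1) *
          Complex.exp (2 * ↑π * Complex.I * τ) ^ ((mp.1 + 1) * (mp.2 + 1))) := fun mp => by
    have hm : (mp.1 : ℂ) + 1 ≠ 0 := Nat.cast_add_one_ne_zero _
    have hp : (mp.2 : ℂ) + 1 ≠ 0 := Nat.cast_add_one_ne_zero _
    have hassoc : ∀ t, w t * g mp t = w t *
        (Complex.exp (2 * ↑π * Complex.I * ((mp.1 : ℂ) + 1) * t) + (-1 : ℂ) ^ (ν + 2) *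
          Complex.exp (-(2 * ↑π * Complex.I * ((mp.1 : ℂ) + 1) * t))) *
        (((mp.2 : ℂ) + 1) ^ (ν + 1) *
          Complex.exp (2 * ↑π * Complex.I * τ) ^ ((mp.1 + 1) * (mp.2 + 1))) := fun t => by
      simp only [g]
      ring
    simp_rw [hassoc]
    rw [intervalIntegral.integral_mul_const, hint, Finset.sum_mul]
    refine Finset.sum_congr rfl fun i _ => ?_
    rw [mul_pow]
    field_simp
    ring
  have hsum' : HasSum (fun mp => ∫ t in (0 : ℝ)..1, w t * g mp t)
      (∑ i ∈ Finset.range R, e i * lambertSeries (ν + 2 + i) (i + 1) τ) := by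
    simp_rw [hterm]
    exact hasSum_sum fun i _ => (summable_lambertSeries _ _ hτ).hasSum.mul_left _
  have hint₁ : IntervalIntegrable (fun t => w t * (A * B)) volume 0 1 :=
    (hwc.mul continuous_const).intervalIntegrable _ _
  have hint₂ : IntervalIntegrable (fun t => A * (w t * ∑' mp, g mp t)) volume 0 1 :=
    (continuous_const.mul (hwc.mul hG)).intervalIntegrable _ _
  rw [hAell, intervalIntegral.integral_sub hint₁ hint₂, intervalIntegral.integral_const_mul,
    hsum.unique hsum', sub_eq_add_neg, ← neg_mul, Finset.mul_sum]
  simp only [mul_assoc, w]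

/-- The weight `-w` slash translates of `f` span a finite-dimensional space. -/
def HasFiniteSlashSpan (w : ℕ) (f : ℂ → ℂ) : Prop :=
  FiniteDimensional ℂ (Submodule.span ℂ (Set.range fun γ => slashTranslate w γ f))

lemma HasFiniteSlashSpan.of_mem {w : ℕ} {f : ℂ → ℂ} {W : Submodule ℂ ({z : ℂ // 0 < z.im} → ℂ)}
    (hfin : FiniteDimensional ℂ W) (hW : ∀ γ, slashTranslate w γ f ∈ W) :
    HasFiniteSlashSpan w f :=
  Submodule.finiteDimensional_of_le (Submodule.span_le.mpr (Set.range_subset_iff.mpr hW))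

lemma slashTranslate_congr {w : ℕ} {f g : ℂ → ℂ} (hfg : ∀ z : ℂ, 0 < z.im → f z = g z)
    (γ : Matrix.SpecialLinearGroup (Fin 2) ℤ) : slashTranslate w γ f = slashTranslate w γ g := by
  ext τ
  simp [slashTranslate, hfg _ (moebius_im_pos γ τ.2)]

lemma HasFiniteSlashSpan.add {w : ℕ} {f g : ℂ → ℂ} (hf : HasFiniteSlashSpan w f)
    (hg : HasFiniteSlashSpan w g) : HasFiniteSlashSpan w (f + g) := by
  unfold HasFiniteSlashSpan at hf hg
  refine .of_mem (Submodule.finiteDimensional_sup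
    (Submodule.span ℂ (Set.range fun γ => slashTranslate w γ f))
    (Submodule.span ℂ (Set.range fun γ => slashTranslate w γ g))) fun γ => ?_
  rw [map_add]
  exact Submodule.add_mem_sup (Submodule.subset_span ⟨γ, rfl⟩) (Submodule.subset_span ⟨γ, rfl⟩)

lemma HasFiniteSlashSpan.const_smul {w : ℕ} {f : ℂ → ℂ} (hf : HasFiniteSlashSpan w f) (c : ℂ) :
    HasFiniteSlashSpan w (c • f) := by
  refine .of_mem hf fun γ => ?_
  rw [map_smul]
  exact Submodule.smul_mem _ c (Submodule.subset_span ⟨γ, rfl⟩)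

lemma hasFiniteSlashSpan_const (w : ℕ) (c : ℂ) : HasFiniteSlashSpan w fun _ => c := by
  have : FiniteDimensional ℂ (polyUpper w) := by unfold polyUpper; infer_instance
  refine .of_mem this fun γ => ?_
  obtain ⟨Q, hQ, hQ'⟩ := exists_polynomial_moebius γ (m := w) (P := Polynomial.C c)
    (Polynomial.mem_degreeLT.mpr (Polynomial.degree_C_le.trans_lt (by exact_mod_cast w.succ_pos)))
  refine ⟨Q, hQ, ?_⟩
  ext τ
  simpa [slashTranslate] using (hQ' τ.1 τ.2).symm

lemma HasFiniteSlashSpan.sum {w : ℕ} {ι : Type*} (s : Finset ι) {f : ι → ℂ → ℂ}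
    (hf : ∀ i ∈ s, HasFiniteSlashSpan w (f i)) : HasFiniteSlashSpan w (∑ i ∈ s, f i) :=
  Finset.sum_induction f _ (fun _ _ => .add) (hasFiniteSlashSpan_const w 0) hf

lemma hasFiniteSlashSpan_lambertSeries {m w s : ℕ} (hm : 1 ≤ m) (hm2 : Even m) (hsw : s + 1 ≤ w)
    (hsm : s ≤ m) : HasFiniteSlashSpan w (lambertSeries (m + 1) (s + 1)) := by
  obtain ⟨c, hc, hmod⟩ := exists_modular_lambertSeries hm hm2
  obtain ⟨F, hF, hF'⟩ := exists_mem_iteratedPrimitive_eq_lambertSeries hc (m + 1) s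
  refine .of_mem (finiteDimensional_polyUpper_mul
    (exists_primitive_mul_add_lambertSeries c (m + 1)) w (m + 1)) fun γ => ?_
  rw [slashTranslate_congr hF' γ]
  exact slashTranslate_mem hsw (by omega) γ (hmod γ) hF

/-- For `n ≥ 2`, `r ≥ 1`, the `ℂ`-span of the weight-`(1−r)` slash translates
`τ ↦ (cτ+d)^{r−1} A_{n,r}((aτ+b)/(cτ+d))`, over all `(a b; c d) ∈ SL₂(ℤ)`, is a
finite-dimensional space of functions on the upper half-plane. -/
theorem AellDepthOne_slash_span_finiteDimensional (n r : ℕ) (hn : 2 ≤ n) (hr : 1 ≤ r) :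
    FiniteDimensional ℂ
      ↥(Submodule.span ℂ
        {g : {z : ℂ // 0 < z.im} → ℂ |
          ∃ γ : Matrix.SpecialLinearGroup (Fin 2) ℤ,
            g = fun τ : {z : ℂ // 0 < z.im} =>
              (((γ : Matrix (Fin 2) (Fin 2) ℤ) 1 0 : ℂ) * τ.1 +
                  ((γ : Matrix (Fin 2) (Fin 2) ℤ) 1 1 : ℂ)) ^ (r - 1) *
                AellDepthOne n r
                  ((((γ : Matrix (Fin 2) (Fin 2) ℤ) 0 0 : ℂ) * τ.1 +
                      ((γ : Matrix (Fin 2) (Fin 2) ℤ) 0 1 : ℂ)) /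
                    (((γ : Matrix (Fin 2) (Fin 2) ℤ) 1 0 : ℂ) * τ.1 +
                      ((γ : Matrix (Fin 2) (Fin 2) ℤ) 1 1 : ℂ)))}) := by

  obtain ⟨ν, rfl⟩ := Nat.exists_eq_add_of_le' hn
  obtain ⟨R, rfl⟩ := Nat.exists_eq_add_of_le' hr
  obtain ⟨C, e, he, hA⟩ := exists_AellDepthOne_eq ν R
  have hsum : HasFiniteSlashSpan R
      ((fun _ => C) + ∑ i ∈ Finset.range R, e i • lambertSeries (ν + 2 + i) (i + 1)) := by
    refine (hasFiniteSlashSpan_const R C).add (.sum _ fun i hi => ?_)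
    by_cases hpar : Even (ν + 1 + i)
    · rw [show ν + 2 + i = ν + 1 + i + 1 by omega]
      exact (hasFiniteSlashSpan_lambertSeries (by omega) hpar (Finset.mem_range.mp hi)
        (by omega)).const_smul _
    · rw [he i hpar, zero_smul]
      exact hasFiniteSlashSpan_const R 0
  unfold HasFiniteSlashSpan at hsum
  refine Submodule.finiteDimensional_of_le (Submodule.span_le.mpr ?_) (S₂ := Submodule.span ℂ
    (Set.range fun γ => slashTranslate R γ
      ((fun _ => C) + ∑ i ∈ Finset.range R, e i • lambertSeries (ν + 2 + i) (i + 1))))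
  rintro _ ⟨γ, rfl⟩
  refine Submodule.subset_span ⟨γ, slashTranslate_congr (fun z hz => ?_) γ⟩
  simp [hA z hz]
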